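/- Existence of the maximal homogeneous partition (soundness of Algorithm 1 / structure underlying Theorem 1): let 𝒞 be a finite multi-resolution cluster set on a finite nonempty set D with layers 𝒞₁, …, 𝒞_{n_c}, and let P be a predicate on subsets of D such that every cluster in the last layer 𝒞_{n_c} satisfies P. Then the collection 𝒞* of all maximal P-clusters of 𝒞 is a partition of D: its members are nonoverlapping (pairwise disjoint) and their union is D. -/

import Mathlib

/-- A multi-resolution cluster set (Definition 2 of the paper) on a finite
set `D`: a family of clusters organized in layers `0, …, nc − 1`, where each
layer consists of pairwise disjoint clusters covering `D`, and each cluster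
of layer `k` (for `k ≥ 1`) is contained in some cluster of layer `k − 1`. -/
structure MRCSet (D : Type*) [DecidableEq D] [Fintype D] where
  /-- number of layers -/
  nc : ℕ
  /-- the clusters of each layer -/
  layer : Fin nc → Finset (Finset D)
  /-- clusters in the same layer are disjoint -/
  layer_disjoint : ∀ k : Fin nc, ∀ C₁ ∈ layer k, ∀ C₂ ∈ layer k,
    C₁ ≠ C₂ → Disjoint C₁ C₂
  /-- every individual belongs to some cluster in each layer -/
  layer_covers : ∀ k : Fin nc, ∀ i : D, ∃ C ∈ layer k, i ∈ C
  /-- each cluster of layer `k ≥ 1` is contained in a cluster of layer `k − 1` -/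
  nested : ∀ k : Fin nc, 1 ≤ (k : ℕ) → ∀ C ∈ layer k,
    ∃ C' ∈ layer ⟨(k : ℕ) - 1, lt_of_le_of_lt (Nat.sub_le _ _) k.isLt⟩, C ⊆ C'

/-- `C` is a cluster of the multi-resolution cluster set `𝒞`. -/
def MRCSet.Mem {D : Type*} [DecidableEq D] [Fintype D]
    (𝒞 : MRCSet D) (C : Finset D) : Prop :=
  ∃ k : Fin 𝒞.nc, C ∈ 𝒞.layer k

/-- `C` is a maximal `P`-cluster of `𝒞`: it is a cluster of `𝒞` satisfying
`P`, and no cluster of `𝒞` satisfying `P` strictly contains it. -/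
def MRCSet.IsMaximal {D : Type*} [DecidableEq D] [Fintype D]
    (𝒞 : MRCSet D) (P : Finset D → Prop) (C : Finset D) : Prop :=
  𝒞.Mem C ∧ P C ∧ ¬ ∃ C' : Finset D, 𝒞.Mem C' ∧ P C' ∧ C ⊂ C'

theorem MRCSet.exists_ancestor {D : Type*} [DecidableEq D] [Fintype D]
    (𝒞 : MRCSet D) (d : ℕ) : ∀ (j k : Fin 𝒞.nc), (j : ℕ) = k + d → ∀ C ∈ 𝒞.layer j,
      ∃ C' ∈ 𝒞.layer k, C ⊆ C' := by
  induction d with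
  | zero =>
    intro j k h C hC
    have : j = k := Fin.ext (by simpa using h)
    subst this
    exact ⟨C, hC, Finset.Subset.refl _⟩
  | succ d ih =>
    intro j k h C hC
    obtain ⟨C₁, h₁, hs⟩ := 𝒞.nested j (by omega) C hC
    obtain ⟨C₂, h₂, hs₂⟩ := ih _ k (by simp only []; omega) C₁ h₁
    exact ⟨C₂, h₂, hs.trans hs₂⟩

/-- Two clusters of `𝒞` are nested or disjoint. -/
theorem MRCSet.subset_or_disjoint {D : Type*} [DecidableEq D] [Fintype D]
    (𝒞 : MRCSet D) (j k : Fin 𝒞.nc) (hjk : (k : ℕ) ≤ j) (A B : Finset D)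
    (hA : A ∈ 𝒞.layer j) (hB : B ∈ 𝒞.layer k) : A ⊆ B ∨ Disjoint A B := by
  obtain ⟨C, hC, hs⟩ := 𝒞.exists_ancestor (j - k) j k (by omega) A hA
  by_cases h : C = B
  · exact Or.inl (h ▸ hs)
  · exact Or.inr (Finset.disjoint_of_subset_left hs (𝒞.layer_disjoint k C hC B hB h))

/-- Existence of the maximal homogeneous partition (soundness of Algorithm 1 /
structure underlying Theorem 1): if every cluster of the last layer satisfies
`P`, then the maximal `P`-clusters of `𝒞` form a partition of `D`: they are
pairwise disjoint and every individual belongs to one of them. -/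
theorem MRCSet.maximal_partition_exists {D : Type*} [DecidableEq D] [Fintype D]
    [Nonempty D] (𝒞 : MRCSet D) (hnc : 0 < 𝒞.nc) (P : Finset D → Prop)
    (hlast : ∀ C ∈ 𝒞.layer ⟨𝒞.nc - 1, by omega⟩, P C) :
    (∀ C₁ C₂ : Finset D, 𝒞.IsMaximal P C₁ → 𝒞.IsMaximal P C₂ →
        C₁ ≠ C₂ → Disjoint C₁ C₂) ∧
    (∀ i : D, ∃ C : Finset D, 𝒞.IsMaximal P C ∧ i ∈ C) := by
  constructor
  · rintro A B ⟨⟨j, hj⟩, hPA, hA⟩ ⟨⟨k, hk⟩, hPB, hB⟩ hne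
    rcases le_total (k : ℕ) j with h | h
    · rcases 𝒞.subset_or_disjoint j k h A B hj hk with h' | h'
      · exact absurd ⟨B, ⟨k, hk⟩, hPB, h'.ssubset_of_ne hne⟩ hA
      · exact h'
    · rcases 𝒞.subset_or_disjoint k j h B A hk hj with h' | h'
      · exact absurd ⟨A, ⟨j, hj⟩, hPA, h'.ssubset_of_ne hne.symm⟩ hB
      · exact h'.symm
  · intro i
    obtain ⟨C₀, h₀, hi₀⟩ := 𝒞.layer_covers ⟨𝒞.nc - 1, by omega⟩ i
    obtain ⟨C, hC⟩ := (Set.toFinite {C : Finset D | 𝒞.Mem C ∧ P C ∧ i ∈ C}).exists_maximal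
      ⟨C₀, ⟨_, h₀⟩, hlast C₀ h₀, hi₀⟩
    refine ⟨C, ⟨hC.prop.1, hC.prop.2.1, ?_⟩, hC.prop.2.2⟩
    rintro ⟨C', hM, hP, hs⟩
    exact hs.2 (hC.le_of_ge ⟨hM, hP, hs.1 hC.prop.2.2⟩ hs.1)
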